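/- Let G be a finite connected simple graph and c₀ an initial configuration from which chip-firing terminates. Let k^j and k'^{j'} be two distinct moves such that there exists a firing sequence from c₀ in which the j'-th firing at k' occurs strictly before the j-th firing at k. Then c(k'^{j'}) is not reachable from c(k^j) by any sequence of firing moves. -/

import Mathlib

/-!  Chip-firing on a finite simple graph. -/

/-- One chip-firing move at vertex `k`: `k` loses `deg k` chips and each of its
neighbors gains one chip. -/
def gfire {V : Type*} [Fintype V] [DecidableEq V] (G : SimpleGraph V) [DecidableRel G.Adj]
    (c : V → ℕ) (k : V) : V → ℕ :=
  fun v => if v = k then c k - G.degree k else if G.Adj k v then c v + 1 else c v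

/-- Apply a list of firing moves in order. -/
def gapply {V : Type*} [Fintype V] [DecidableEq V] (G : SimpleGraph V) [DecidableRel G.Adj]
    (c : V → ℕ) : List V → (V → ℕ)
  | [] => c
  | k :: s => gapply G (gfire G c k) s

/-- The list of vertices `s` is a legal firing sequence from `c`: every fired vertex
has at least as many chips as its degree at the moment it is fired. -/
def GLegal {V : Type*} [Fintype V] [DecidableEq V] (G : SimpleGraph V) [DecidableRel G.Adj]
    (c : V → ℕ) : List V → Prop
  | [] => True
  | k :: s => G.degree k ≤ c k ∧ GLegal G (gfire G c k) s

/-- `c₂` is reachable from `c₁` by a sequence of firing moves. -/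
def GReachable {V : Type*} [Fintype V] [DecidableEq V] (G : SimpleGraph V) [DecidableRel G.Adj]
    (c₁ c₂ : V → ℕ) : Prop :=
  ∃ s, GLegal G c₁ s ∧ gapply G c₁ s = c₂

/-- Vertex `k` is ready to fire in `c`. -/
def GReady {V : Type*} [Fintype V] [DecidableEq V] (G : SimpleGraph V) [DecidableRel G.Adj]
    (c : V → ℕ) (k : V) : Prop := G.degree k ≤ c k

/-- No vertex is ready to fire in `c`. -/
def GStable {V : Type*} [Fintype V] [DecidableEq V] (G : SimpleGraph V) [DecidableRel G.Adj]
    (c : V → ℕ) : Prop := ∀ k, c k < G.degree k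

/-- Some legal firing sequence from `c₀` performs the `j'`-th firing at `k'`
strictly before the `j`-th firing at `k`: there is a legal sequence with a prefix `t`
containing exactly `j' - 1` firings at `k'` and fewer than `j` firings at `k`,
immediately followed by a firing at `k'`. -/
def GFiresBefore {V : Type*} [Fintype V] [DecidableEq V] (G : SimpleGraph V) [DecidableRel G.Adj]
    (c₀ : V → ℕ) (k' : V) (j' : ℕ) (k : V) (j : ℕ) : Prop :=
  ∃ t u : List V, GLegal G c₀ (t ++ k' :: u) ∧ t.count k' = j' - 1 ∧ t.count k < j

/-- The move-poset order: move `p = (k, j)` (the `j`-th firing at `k`) satisfies `p ≥ q`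
iff `p = q` or no legal firing sequence from `c₀` performs move `q` strictly before `p`. -/
def GMoveGE {V : Type*} [Fintype V] [DecidableEq V] (G : SimpleGraph V) [DecidableRel G.Adj]
    (c₀ : V → ℕ) (p q : V × ℕ) : Prop :=
  p = q ∨ ¬ GFiresBefore G c₀ q.1 q.2 p.1 p.2

section ChipFiring

variable {V : Type*} [Fintype V] [DecidableEq V] (G : SimpleGraph V) [DecidableRel G.Adj]

theorem gapply_append (c : V → ℕ) (s t : List V) :
    gapply G c (s ++ t) = gapply G (gapply G c s) t := by
  induction s generalizing c with
  | nil => rfl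
  | cons k s ih => exact ih _

theorem gLegal_append (c : V → ℕ) (s t : List V) :
    GLegal G c (s ++ t) ↔ GLegal G c s ∧ GLegal G (gapply G c s) t := by
  induction s generalizing c with
  | nil => simp [GLegal, gapply]
  | cons k s ih => simp [GLegal, gapply, ih, and_assoc]

theorem gfire_add_degree {c : V → ℕ} {k : V} (hk : G.degree k ≤ c k) (v : V) :
    gfire G c k v + (if k = v then G.degree v else 0) = c v + if G.Adj k v then 1 else 0 := by
  by_cases hkv : k = v
  · subst hkv
    simp [gfire, Nat.sub_add_cancel hk]
  · have hvk : v ≠ k := Ne.symm hkv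
    by_cases h : G.Adj k v <;> simp [gfire, hkv, hvk, h]

/-- Conservation of chips at a vertex along a legal firing sequence. -/
theorem gapply_add_degree_mul_count {c : V → ℕ} {s : List V} (hs : GLegal G c s) (v : V) :
    gapply G c s v + G.degree v * s.count v = c v + ∑ u ∈ G.neighborFinset v, s.count u := by
  induction s generalizing c with
  | nil => simp [gapply]
  | cons k s ih =>
    have hfire := gfire_add_degree G hs.1 v
    have hsum : ∑ u ∈ G.neighborFinset v, (k :: s).count u =
        ∑ u ∈ G.neighborFinset v, s.count u + if G.Adj k v then 1 else 0 := by
      simp [List.count_cons, Finset.sum_add_distrib, G.adj_comm]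
    have hrec := ih hs.2
    rw [hsum, List.count_cons]
    simp only [beq_iff_eq, gapply]
    split_ifs at hfire ⊢ <;> simp only [mul_add, mul_one] <;> omega

/-- Least action principle: a legal sequence `t` fires no vertex more often than a legal
sequence `s` does, provided this holds for the vertices that are ready after `s`. -/
theorem count_le_of_ready_imp {c : V → ℕ} {s t : List V} (hs : GLegal G c s)
    (ht : GLegal G c t) (h : ∀ v, GReady G (gapply G c s) v → t.count v ≤ s.count v) (v : V) :
    t.count v ≤ s.count v := by
  induction t using List.reverseRecOn generalizing v with
  | nil => simp
  | append_singleton p k ih =>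
    obtain ⟨hp, hk, -⟩ := (gLegal_append G c p [k]).1 ht
    have hle := ih hp fun v hv =>
      (List.Sublist.count_le v (List.sublist_append_left p [k])).trans (h v hv)
    rcases eq_or_ne k v with rfl | hkv
    · rcases (hle k).lt_or_eq with hlt | heq
      · simpa [List.count_append] using hlt
      · refine h k ?_
        have h₁ := gapply_add_degree_mul_count G hp k
        have h₂ := gapply_add_degree_mul_count G hs k
        have hsum := Finset.sum_le_sum fun u (_ : u ∈ G.neighborFinset k) => hle u
        rw [heq] at h₁
        unfold GReady
        omega
    · simpa [List.count_append, List.count_singleton, hkv] using hle v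

theorem length_le_of_gStable {c : V → ℕ} {s t : List V} (hs : GLegal G c s)
    (hstable : GStable G (gapply G c s)) (ht : GLegal G c t) : t.length ≤ s.length := by
  refine List.Subperm.length_le (List.subperm_iff_count.2 fun v => ?_)
  exact count_le_of_ready_imp G hs ht (fun v hv => absurd hv (hstable v).not_ge) v

/-- If some legal sequence stabilizes `c`, every legal sequence extends to such a one. -/
theorem exists_stabilizing_extension {c : V → ℕ}
    (hterm : ∃ s, GLegal G c s ∧ GStable G (gapply G c s)) {t : List V} (ht : GLegal G c t) :
    ∃ u, GLegal G (gapply G c t) u ∧ GStable G (gapply G (gapply G c t) u) := by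
  obtain ⟨s, hs, hstable⟩ := hterm
  induction hn : s.length - t.length generalizing t with
  | zero =>
    refine ⟨[], trivial, fun k => ?_⟩
    by_contra! hk
    have hlen := length_le_of_gStable G hs hstable
      ((gLegal_append G c t [k]).2 ⟨ht, hk, trivial⟩)
    simp only [List.length_append, List.length_singleton] at hlen
    omega
  | succ n ih =>
    by_cases hst : GStable G (gapply G c t)
    · exact ⟨[], trivial, hst⟩
    · obtain ⟨k, hk⟩ := not_forall.1 hst
      have htk := (gLegal_append G c t [k]).2 ⟨ht, not_lt.1 hk, trivial⟩
      obtain ⟨u, hu, hust⟩ := ih htk (by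
        simp only [List.length_append, List.length_singleton]; omega)
      rw [gapply_append] at hu hust
      exact ⟨k :: u, ⟨not_lt.1 hk, hu⟩, hust⟩

end ChipFiring

/-- If move `k'^{j'}` can occur before move `k^j` (some firing sequence
from `c₀` performs the `j'`-th firing at `k'` strictly before the `j`-th firing at `k`),
then `c(k'^{j'})` is not reachable from `c(k^j)`. -/
theorem not_reachable_of_can_occur_before
    {V : Type*} [Fintype V] [DecidableEq V] (G : SimpleGraph V) [DecidableRel G.Adj]
    (hG : G.Connected) (c₀ : V → ℕ)
    (hterm : ∃ s, GLegal G c₀ s ∧ GStable G (gapply G c₀ s))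
    (N : V → ℕ)
    (hN : ∀ s, GLegal G c₀ s → GStable G (gapply G c₀ s) → ∀ k, s.count k = N k)
    (k k' : V) (j j' : ℕ)
    (hj1 : 1 ≤ j) (hj2 : j ≤ N k) (hj'1 : 1 ≤ j') (hj'2 : j' ≤ N k')
    (hne : (k, j) ≠ (k', j'))
    (hbefore : GFiresBefore G c₀ k' j' k j)
    -- `c₁ = c(k^j)` : the configuration in which `k^j` is the only available move
    (c₁ : V → ℕ) (s₁ : List V)
    (hs₁ : GLegal G c₀ s₁) (hc₁ : gapply G c₀ s₁ = c₁) (hcount₁ : s₁.count k = j - 1)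
    (hready₁ : ∀ v, GReady G c₁ v ↔ v = k)
    -- `c₂ = c(k'^{j'})` : the configuration in which `k'^{j'}` is the only available move
    (c₂ : V → ℕ) (s₂ : List V)
    (hs₂ : GLegal G c₀ s₂) (hc₂ : gapply G c₀ s₂ = c₂) (hcount₂ : s₂.count k' = j' - 1)
    (hready₂ : ∀ v, GReady G c₂ v ↔ v = k') :
    ¬ GReachable G c₁ c₂ := by
  rintro ⟨s, hs, hsc⟩
  obtain ⟨t, u, htu, htk', htk⟩ := hbefore
  subst hc₁ hc₂
  have ht : GLegal G c₀ (t ++ [k']) := 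
    ((gLegal_append G c₀ (t ++ [k']) u).1 (by simpa using htu)).1
  have hk' : j' ≤ s₁.count k' := by
    have hle := count_le_of_ready_imp G hs₁ ht (fun v hv => ?_) k'
    · simp only [List.count_append, List.count_singleton_self] at hle
      omega
    · obtain rfl := (hready₁ v).1 hv
      rw [List.count_append, List.count_singleton, hcount₁]
      by_cases hkk : k' = v
      · subst hkk
        have hjj : j ≠ j' := fun h => hne (h ▸ rfl)
        simp only [beq_self_eq_true, if_true]
        omega
      · simp only [beq_iff_eq, hkk, if_false]
        omega
  obtain ⟨w, hw, hwst⟩ := exists_stabilizing_extension G hterm hs₂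
  have hs₁s : GLegal G c₀ (s₁ ++ s) := (gLegal_append G c₀ s₁ s).2 ⟨hs₁, hs⟩
  have hend : gapply G c₀ (s₁ ++ s) = gapply G c₀ s₂ := by rw [gapply_append, hsc]
  have hN₁ := hN (s₁ ++ s ++ w) ((gLegal_append G c₀ _ w).2 ⟨hs₁s, hend ▸ hw⟩)
    (by rw [gapply_append, hend]; exact hwst) k'
  have hN₂ := hN (s₂ ++ w) ((gLegal_append G c₀ _ w).2 ⟨hs₂, hw⟩)
    (by rw [gapply_append]; exact hwst) k'
  simp only [List.count_append] at hN₁ hN₂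
  omega
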